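/- For every integer m ≥ 1, every m-ultra number is transcendental over ℚ. -/

import Mathlib

open Polynomial

/-- The primitive minimal polynomial over ℤ of a real number. -/
noncomputable def intMinpoly (α : ℝ) : Polynomial ℤ :=
  (IsLocalization.integerNormalization (nonZeroDivisors ℤ) (minpoly ℚ α)).primPart

/-- The height of an algebraic number: the maximum of the absolute values of the
coefficients of its primitive minimal polynomial over ℤ. -/
noncomputable def algHeight (α : ℝ) : ℕ :=
  (intMinpoly α).support.sup fun i => ((intMinpoly α).coeff i).natAbs

/-- `α` is a real algebraic number of degree exactly `m`. -/
def DegreeExactly (m : ℕ) (α : ℝ) : Prop :=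
  IsAlgebraic ℚ α ∧ (minpoly ℚ α).natDegree = m

/-- `exp^[3](x) = e^(e^(e^x))`. -/
noncomputable def expCube (x : ℝ) : ℝ := Real.exp (Real.exp (Real.exp x))

/-- `ξ` is an `m`-ultra number: there is a sequence `(α_n)_{n ≥ 1}` of pairwise distinct
real algebraic numbers of degree exactly `m` with
`0 < |ξ - α_n| < (exp^[3](H(α_n)))^{-n}` for all `n ≥ 1`. Here `a k` plays the
role of `α_{k+1}`. -/
def IsMUltra (m : ℕ) (ξ : ℝ) : Prop :=
  ∃ a : ℕ → ℝ, Function.Injective a ∧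
    ∀ n : ℕ, DegreeExactly m (a n) ∧ 0 < |ξ - a n| ∧
      |ξ - a n| < (expCube (algHeight (a n)))⁻¹ ^ (n + 1)

/-- A function `f : ℝ → ℝ` is transcendental if the only complex two-variable polynomial
`P` with `P (x, f x) = 0` for all real `x` is the zero polynomial. -/
def TranscendentalFun (f : ℝ → ℝ) : Prop :=
  ∀ P : MvPolynomial (Fin 2) ℂ,
    (∀ x : ℝ, MvPolynomial.eval ![(x : ℂ), (f x : ℂ)] P = 0) → P = 0

lemma norm_intCast_le {a : ℤ} {H : ℕ} (h : a.natAbs ≤ H) : ‖(a : ℂ)‖ ≤ H := by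
  rw [Complex.norm_intCast, ← Int.cast_abs, Int.abs_eq_natAbs, Int.cast_natCast]
  exact Nat.cast_le.2 h

/-- A root `z` of an integer polynomial satisfies `|a| * |z| ≤ 2 * H`, where `a` is the leading
coefficient and `H` bounds the coefficients. -/
lemma norm_leadingCoeff_mul_root_le {p : ℤ[X]} (hp : p ≠ 0) {H : ℕ}
    (hH : ∀ i, (p.coeff i).natAbs ≤ H) {z : ℂ} (hz : aeval z p = 0) :
    ‖(p.leadingCoeff : ℂ) * z‖ ≤ 2 * H := by
  set q : ℂ[X] := p.map (Int.castRingHom ℂ) with hq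
  have hinj : Function.Injective (Int.castRingHom ℂ) := RingHom.injective_int _
  have hq0 : q ≠ 0 := (Polynomial.map_ne_zero_iff hinj).2 hp
  have hroot : q.IsRoot z := by
    rw [IsRoot.def, hq, eval_map]
    exact hz
  have hcoeff (i : ℕ) : ‖q.coeff i‖₊ ≤ (H : NNReal) := by
    rw [← NNReal.coe_le_coe, coe_nnnorm, hq, coeff_map, eq_intCast]
    exact norm_intCast_le (hH i)
  have hlead : q.leadingCoeff = p.leadingCoeff := by
    rw [hq, leadingCoeff_map_of_injective hinj, eq_intCast]
  have hlt := hroot.norm_lt_cauchyBound hq0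
  have hpos : 0 < ‖q.leadingCoeff‖₊ := by simpa using hq0
  rw [← hlead]
  have key : ‖q.leadingCoeff * z‖₊ ≤ 2 * (H : NNReal) :=
    calc ‖q.leadingCoeff * z‖₊ = ‖q.leadingCoeff‖₊ * ‖z‖₊ := nnnorm_mul _ _
      _ ≤ ‖q.leadingCoeff‖₊ * cauchyBound q := by gcongr
      _ = (Finset.range q.natDegree).sup (‖q.coeff ·‖₊) + ‖q.leadingCoeff‖₊ := by
        rw [cauchyBound]
        field_simp
      _ ≤ H + H := add_le_add (Finset.sup_le fun i _ => hcoeff i) (hcoeff _)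
      _ = 2 * (H : NNReal) := (two_mul _).symm
  exact_mod_cast key

/-- A nonzero algebraic integer has norm at least one in absolute value, so no conjugate can be
too small when the others are bounded. -/
lemma one_le_norm_mul_pow_of_isIntegral {K : Type*} [Field K] [NumberField K] {γ : K}
    (hγ : IsIntegral ℤ γ) (hγ0 : γ ≠ 0) {M : ℝ} (hM : ∀ σ : K →ₐ[ℚ] ℂ, ‖σ γ‖ ≤ M)
    (τ : K →ₐ[ℚ] ℂ) :
    1 ≤ ‖τ γ‖ * M ^ (Module.finrank ℚ K - 1) := by
  classical
  have hnorm : IsIntegral ℤ (Algebra.norm ℚ γ) := Algebra.isIntegral_norm ℚ hγ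
  obtain ⟨k, hk⟩ := IsIntegrallyClosed.isIntegral_iff.1 hnorm
  have hk0 : k ≠ 0 := by
    rintro rfl
    rw [map_zero] at hk
    exact hγ0 (Algebra.norm_eq_zero_iff.1 hk.symm)
  have hprod := Algebra.norm_eq_prod_embeddings ℚ ℂ γ
  have hone : (1 : ℝ) ≤ ‖∏ σ : K →ₐ[ℚ] ℂ, σ γ‖ := by
    rw [← hprod, ← hk]
    simp only [eq_intCast, map_intCast, Complex.norm_intCast]
    exact_mod_cast Int.one_le_abs hk0
  rw [norm_prod, ← Finset.mul_prod_erase _ _ (Finset.mem_univ τ)] at hone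
  refine hone.trans (mul_le_mul_of_nonneg_left ?_ (norm_nonneg _))
  calc ∏ σ ∈ Finset.univ.erase τ, ‖σ γ‖ ≤ ∏ _σ ∈ Finset.univ.erase τ, M :=
        Finset.prod_le_prod (fun _ _ => norm_nonneg _) fun σ _ => hM σ
    _ = M ^ (Module.finrank ℚ K - 1) := by
        rw [Finset.prod_const, Finset.card_erase_of_mem (Finset.mem_univ _), Finset.card_univ,
          AlgHom.card]

/-- Liouville's inequality for two distinct elements of a number field. -/
lemma one_le_norm_sub_mul_pow {K : Type*} [Field K] [NumberField K] {x y : K} (hxy : x ≠ y)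
    {p q : ℤ[X]} (hp : p ≠ 0) (hq : q ≠ 0) (hx : aeval x p = 0) (hy : aeval y q = 0) {A B : ℕ}
    (hA : ∀ i, (p.coeff i).natAbs ≤ A) (hB : ∀ i, (q.coeff i).natAbs ≤ B) (τ : K →ₐ[ℚ] ℂ) :
    1 ≤ ‖τ x - τ y‖ * (4 * A * B : ℝ) ^ Module.finrank ℚ K := by
  have aeval_map_eq_zero {r : ℤ[X]} {z : K} (hz : aeval z r = 0) (σ : K →ₐ[ℚ] ℂ) :
      aeval (σ z) r = 0 := by
    have := aeval_algHom_apply (σ.restrictScalars ℤ) z r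
    simpa [hz] using this
  set γ : K := q.leadingCoeff * (p.leadingCoeff * x) - p.leadingCoeff * (q.leadingCoeff * y)
    with hγ
  have hγ' : γ = p.leadingCoeff * q.leadingCoeff * (x - y) := by rw [hγ]; ring
  have hγint : IsIntegral ℤ γ := by
    have h1 := isIntegral_leadingCoeff_smul p x hx
    have h2 := isIntegral_leadingCoeff_smul q y hy
    rw [zsmul_eq_mul] at h1 h2
    exact (isIntegral_algebraMap.mul h1).sub (isIntegral_algebraMap.mul h2)
  have hγ0 : γ ≠ 0 := by
    rw [hγ']
    refine mul_ne_zero (mul_ne_zero ?_ ?_) (sub_ne_zero.2 hxy) <;> simpa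
  have hbound (σ : K →ₐ[ℚ] ℂ) : ‖σ γ‖ ≤ 4 * A * B := by
    have h1 := norm_leadingCoeff_mul_root_le hp hA (aeval_map_eq_zero hx σ)
    have h2 := norm_leadingCoeff_mul_root_le hq hB (aeval_map_eq_zero hy σ)
    calc ‖σ γ‖ = ‖(q.leadingCoeff : ℂ) * (p.leadingCoeff * σ x)
          - p.leadingCoeff * (q.leadingCoeff * σ y)‖ := by simp [hγ]
      _ ≤ ‖(q.leadingCoeff : ℂ)‖ * ‖p.leadingCoeff * σ x‖
          + ‖(p.leadingCoeff : ℂ)‖ * ‖q.leadingCoeff * σ y‖ := by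
        rw [← norm_mul, ← norm_mul]
        exact norm_sub_le _ _
      _ ≤ B * (2 * A) + A * (2 * B) := by
        gcongr
        exacts [norm_intCast_le (hB _), norm_intCast_le (hA _)]
      _ = 4 * A * B := by ring
  have hτ : ‖τ γ‖ ≤ ‖τ x - τ y‖ * (4 * A * B) :=
    calc ‖τ γ‖ = ‖τ x - τ y‖ * (‖(p.leadingCoeff : ℂ)‖ * ‖(q.leadingCoeff : ℂ)‖) := by
          rw [hγ', ← map_sub]
          simp only [map_mul, map_intCast, norm_mul]
          ring
      _ ≤ ‖τ x - τ y‖ * (A * B) := by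
        gcongr
        exacts [norm_intCast_le (hA _), norm_intCast_le (hB _)]
      _ ≤ ‖τ x - τ y‖ * (4 * A * B) := by
        gcongr
        exact le_mul_of_one_le_left (Nat.cast_nonneg _) (by norm_num)
  calc (1 : ℝ) ≤ ‖τ γ‖ * (4 * A * B) ^ (Module.finrank ℚ K - 1) :=
        one_le_norm_mul_pow_of_isIntegral hγint hγ0 hbound τ
    _ ≤ ‖τ x - τ y‖ * (4 * A * B) * (4 * A * B) ^ (Module.finrank ℚ K - 1) := by gcongr
    _ = ‖τ x - τ y‖ * (4 * A * B : ℝ) ^ Module.finrank ℚ K := by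
        rw [mul_assoc, mul_pow_sub_one Module.finrank_pos.ne']

lemma intMinpoly_ne_zero (α : ℝ) : intMinpoly α ≠ 0 :=
  primPart_ne_zero _

lemma aeval_intMinpoly {α : ℝ} (hα : IsAlgebraic ℚ α) : aeval α (intMinpoly α) = 0 := by
  refine aeval_primPart_eq_zero ?_
    (IsLocalization.integerNormalization_aeval_eq_zero _ _ (minpoly.aeval ℚ α))
  rw [Ne, IsFractionRing.integerNormalization_eq_zero_iff]
  exact minpoly.ne_zero hα.isIntegral

lemma natAbs_coeff_intMinpoly_le (α : ℝ) (i : ℕ) :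
    ((intMinpoly α).coeff i).natAbs ≤ algHeight α := by
  by_cases hi : i ∈ (intMinpoly α).support
  · exact Finset.le_sup (f := fun i => ((intMinpoly α).coeff i).natAbs) hi
  · simp [notMem_support_iff.1 hi]

lemma one_le_algHeight (α : ℝ) : 1 ≤ algHeight α :=
  (Int.natAbs_pos.2 (leadingCoeff_ne_zero.2 (intMinpoly_ne_zero α))).trans_le
    (natAbs_coeff_intMinpoly_le α _)

open IntermediateField in
/-- Liouville's inequality for two distinct real algebraic numbers. -/
lemma one_le_abs_sub_mul_pow {α β : ℝ} (hα : IsAlgebraic ℚ α) (hβ : IsAlgebraic ℚ β)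
    (hne : α ≠ β) :
    1 ≤ |α - β| * (4 * algHeight α * algHeight β : ℝ) ^
      ((minpoly ℚ α).natDegree * (minpoly ℚ β).natDegree) := by
  have : FiniteDimensional ℚ ℚ⟮α⟯ := adjoin.finiteDimensional hα.isIntegral
  have : FiniteDimensional ℚ ℚ⟮β⟯ := adjoin.finiteDimensional hβ.isIntegral
  let K : IntermediateField ℚ ℝ := ℚ⟮α⟯ ⊔ ℚ⟮β⟯
  have : FiniteDimensional ℚ K := finiteDimensional_sup _ _
  have : NumberField K := { }
  let x : K := ⟨α, le_sup_left (a := ℚ⟮α⟯) (mem_adjoin_simple_self ℚ α)⟩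
  let y : K := ⟨β, le_sup_right (b := ℚ⟮β⟯) (mem_adjoin_simple_self ℚ β)⟩
  have hxy : x ≠ y := fun h => hne (congrArg Subtype.val h)
  have hroot {z : K} (hz : IsAlgebraic ℚ (z : ℝ)) : aeval z (intMinpoly z) = 0 := by
    have h := aeval_algHom_apply (K.val.restrictScalars ℤ) z (intMinpoly z)
    have h' := aeval_intMinpoly hz
    exact Subtype.ext (h.symm.trans h')
  let τ : K →ₐ[ℚ] ℂ := (Complex.ofRealAm.restrictScalars ℚ).comp K.val
  have key := one_le_norm_sub_mul_pow hxy (intMinpoly_ne_zero α) (intMinpoly_ne_zero β)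
    (hroot (z := x) hα) (hroot (z := y) hβ) (natAbs_coeff_intMinpoly_le α)
    (natAbs_coeff_intMinpoly_le β) τ
  have hτ : ‖τ x - τ y‖ = |α - β| := by
    change ‖(α : ℂ) - (β : ℂ)‖ = _
    rw [← Complex.ofReal_sub, Complex.norm_real, Real.norm_eq_abs]
  have hdeg : Module.finrank ℚ K ≤ (minpoly ℚ α).natDegree * (minpoly ℚ β).natDegree := by
    rw [← adjoin.finrank hα.isIntegral, ← adjoin.finrank hβ.isIntegral]
    exact finrank_sup_le _ _
  rw [hτ] at key
  have h1 : (1 : ℝ) ≤ 4 * algHeight α * algHeight β := by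
    have := Nat.mul_le_mul (one_le_algHeight α) (one_le_algHeight β)
    have : (1 : ℝ) ≤ algHeight α * algHeight β := by exact_mod_cast this
    linarith
  exact key.trans (mul_le_mul_of_nonneg_left (pow_le_pow_right₀ h1 hdeg) (abs_nonneg _))

lemma one_add_le_expCube (x : ℝ) : 1 + x ≤ expCube x := by
  have h1 := Real.add_one_le_exp x
  have h2 := Real.add_one_le_exp (Real.exp x)
  have h3 := Real.add_one_le_exp (Real.exp (Real.exp x))
  unfold expCube
  linarith

/-- Every `m`-ultra number is transcendental over `ℚ`. -/
theorem stmt_7 (m : ℕ) (hm : 1 ≤ m) (ξ : ℝ) (hξ : IsMUltra m ξ) :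
    Transcendental ℚ ξ := by
  intro hξalg
  obtain ⟨a, -, ha⟩ := hξ
  set D := (minpoly ℚ ξ).natDegree * m with hD
  set B : ℝ := 4 * algHeight ξ with hB
  obtain ⟨k, hk⟩ := pow_unbounded_of_one_lt (B ^ D) (one_lt_two (α := ℝ))
  set n := k + D
  obtain ⟨⟨halg, hdeg⟩, hpos, hlt⟩ := ha n
  set H := (algHeight (a n) : ℝ) with hH
  have hH1 : 1 ≤ H := Nat.one_le_cast.2 (one_le_algHeight (a n))
  have hE : 1 + H ≤ expCube H := one_add_le_expCube H
  have hE0 : 0 < expCube H := by linarith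
  have key := one_le_abs_sub_mul_pow hξalg halg (sub_ne_zero.1 (abs_pos.1 hpos))
  rw [hdeg, ← hD, ← hB, ← hH] at key
  have hpow : (B * H) ^ D ≤ expCube H ^ (n + 1) :=
    calc (B * H) ^ D = B ^ D * H ^ D := mul_pow _ _ _
      _ ≤ 2 ^ k * H ^ D := by gcongr
      _ ≤ expCube H ^ k * expCube H ^ D := by
        gcongr <;> linarith
      _ = expCube H ^ n := (pow_add _ _ _).symm
      _ ≤ expCube H ^ (n + 1) := pow_le_pow_right₀ (by linarith) n.le_succ
  have : |ξ - a n| * (B * H) ^ D < 1 :=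
    calc |ξ - a n| * (B * H) ^ D ≤ |ξ - a n| * expCube H ^ (n + 1) := by gcongr
      _ < (expCube H)⁻¹ ^ (n + 1) * expCube H ^ (n + 1) := by gcongr
      _ = 1 := by rw [← mul_pow, inv_mul_cancel₀ hE0.ne', one_pow]
  exact absurd key this.not_ge
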